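/- For all words w, w′ ∈ W, the ℤ-linear functionals ct ∘ Φ(w) and ct ∘ Φ(w′) on P are equal if and only if there exist integers N, M ≥ 0 such that h₁^N w ≈ h₁^M w′. -/

import Mathlib

/-!
Statement 10.  Setting as in Statement 9 (`P = ℤ[x₁,x₂,…]`, Bergeron–Sottile maps
`R_i`, quasisymmetric divided differences `T_i`, free monoid `W` with the augmented
Thompson congruence `≈`, and `Φ(a₁⋯a_k) = up(a₁) ∘ ⋯ ∘ up(a_k)` with `up(g_i) = T_i`,
`up(h_i) = R_i`).  Let `ct : P → ℤ` be the constant coefficient.  Claim: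
`ct ∘ Φ(w) = ct ∘ Φ(w′)` if and only if `h₁^N w ≈ h₁^M w′` for some `N, M ≥ 0`.
-/

/-- The polynomial ring `ℤ[x₁, x₂, …]` with variables indexed by the positive integers. -/
abbrev PolyP : Type := MvPolynomial ℕ+ ℤ

/-- The Bergeron–Sottile map `R_i : P → P`,
`f(x₁, x₂, …) ↦ f(x₁, …, x_{i−1}, 0, x_i, x_{i+1}, …)`. -/
noncomputable def Rop (i : ℕ+) : PolyP →ₐ[ℤ] PolyP :=
  MvPolynomial.aeval (fun j : ℕ+ =>
    if j < i then MvPolynomial.X j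
    else if j = i then 0
    else MvPolynomial.X (j - 1))

/-- The alphabet `{g_i : i ≥ 1} ∪ {h_i : i ≥ 1}`. -/
inductive Letter : Type
  | g : ℕ+ → Letter
  | h : ℕ+ → Letter

/-- The free monoid on the alphabet. -/
abbrev W : Type := FreeMonoid Letter

open FreeMonoid in
/-- The defining relations of the augmented Thompson monoid. -/
inductive thompsonRel : W → W → Prop
  | gg (i j : ℕ+) : i > j →
      thompsonRel (of (.g i) * of (.g j)) (of (.g j) * of (.g (i + 1)))
  | gh (i j : ℕ+) : i ≥ j →
      thompsonRel (of (.g i) * of (.h j)) (of (.h j) * of (.g (i + 1)))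
  | hg (i j : ℕ+) : i > j →
      thompsonRel (of (.h i) * of (.g j)) (of (.g j) * of (.h (i + 1)))
  | hh (i j : ℕ+) : i ≥ j →
      thompsonRel (of (.h i) * of (.h j)) (of (.h j) * of (.h (i + 1)))

/-- Interpretation of a letter as a ℤ-linear endomorphism of `P`:
`up(g_i) = T_i` and `up(h_i) = R_i`. -/
noncomputable def up (T : ℕ+ → Module.End ℤ PolyP) : Letter → Module.End ℤ PolyP
  | .g i => T i
  | .h i => (Rop i).toLinearMap

/-- `Φ : W → End(P)`, `Φ(a₁⋯a_k) = up(a₁) ∘ up(a₂) ∘ ⋯ ∘ up(a_k)`. -/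
noncomputable def Phi (T : ℕ+ → Module.End ℤ PolyP) : W →* Module.End ℤ PolyP :=
  FreeMonoid.lift (up T)

open MvPolynomial

lemma Rop_X_of_lt {i j : ℕ+} (h : j < i) : Rop i (X j) = X j := by
  simp [Rop, h]

lemma Rop_X_self (i : ℕ+) : Rop i (X i) = 0 := by
  simp [Rop]

lemma Rop_X_add_one {i j : ℕ+} (h : i ≤ j) : Rop i (X (j + 1)) = X j := by
  have h₁ : ¬ j + 1 < i := by pnat_to_nat; omega
  have h₂ : j + 1 ≠ i := by rintro rfl; pnat_to_nat; omega
  have h₃ : j + 1 - 1 = j := by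
    apply PNat.eq
    rw [PNat.sub_coe, if_pos (by pnat_to_nat; omega)]
    simp
  simp [Rop, h₁, h₂, h₃]

/-- Every positive integer is below `i`, equal to `i`, or of the form `k + 1` with `i ≤ k`. -/
lemma pnat_trichotomy (i j : ℕ+) : j < i ∨ j = i ∨ ∃ k, i ≤ k ∧ j = k + 1 := by
  rcases lt_trichotomy j i with h | h | h
  · exact .inl h
  · exact .inr (.inl h)
  · obtain ⟨k, rfl⟩ := PNat.exists_eq_succ_of_ne_one (n := j)
      (by rintro rfl; exact not_lt_one h)
    exact .inr (.inr ⟨k, PNat.lt_add_one_iff.mp h, rfl⟩)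

/-- The section of `Rop i` that skips the variable `x_i`. -/
noncomputable def Sop (i : ℕ+) : PolyP →ₐ[ℤ] PolyP :=
  rename fun j => if j < i then j else j + 1

lemma Sop_X_of_lt {i j : ℕ+} (h : j < i) : Sop i (X j) = X j := by
  simp [Sop, h]

lemma Sop_X_of_le {i j : ℕ+} (h : i ≤ j) : Sop i (X j) = X (j + 1) := by
  simp [Sop, not_lt.mpr h]

lemma Rop_Rop {i j : ℕ+} (h : j ≤ i) (f : PolyP) :
    Rop i (Rop j f) = Rop j (Rop (i + 1) f) := by
  suffices (Rop i).comp (Rop j) = (Rop j).comp (Rop (i + 1)) from DFunLike.congr_fun this f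
  ext1 k
  simp only [AlgHom.comp_apply]
  rcases pnat_trichotomy j k with hk | rfl | ⟨k, hk, rfl⟩
  · rw [Rop_X_of_lt hk, Rop_X_of_lt (hk.trans_le h),
      Rop_X_of_lt (show k < i + 1 by pnat_to_nat; omega), Rop_X_of_lt hk]
  · rw [Rop_X_self, Rop_X_of_lt (show k < i + 1 by pnat_to_nat; omega), Rop_X_self, map_zero]
  rw [Rop_X_add_one hk]
  rcases pnat_trichotomy i k with hi | rfl | ⟨k, hi, rfl⟩
  · rw [Rop_X_of_lt hi, Rop_X_of_lt (show k + 1 < i + 1 by pnat_to_nat; omega),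
      Rop_X_add_one hk]
  · rw [Rop_X_self, Rop_X_self, map_zero]
  · rw [Rop_X_add_one hi, Rop_X_add_one (show i + 1 ≤ k + 1 by pnat_to_nat; omega),
      Rop_X_add_one (h.trans hi)]

lemma Rop_Sop_self (i : ℕ+) (f : PolyP) : Rop i (Sop i f) = f := by
  suffices (Rop i).comp (Sop i) = AlgHom.id ℤ _ from DFunLike.congr_fun this f
  ext1 k
  simp only [AlgHom.comp_apply, AlgHom.id_apply]
  rcases lt_or_ge k i with hk | hk
  · rw [Sop_X_of_lt hk, Rop_X_of_lt hk]
  · rw [Sop_X_of_le hk, Rop_X_add_one hk]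

lemma Rop_add_one_Sop {i j : ℕ+} (h : j ≤ i) (f : PolyP) :
    Rop (i + 1) (Sop j f) = Sop j (Rop i f) := by
  suffices (Rop (i + 1)).comp (Sop j) = (Sop j).comp (Rop i) from DFunLike.congr_fun this f
  ext1 k
  simp only [AlgHom.comp_apply]
  rcases lt_or_ge k j with hk | hk
  · rw [Sop_X_of_lt hk, Rop_X_of_lt (hk.trans_le h), Sop_X_of_lt hk,
      Rop_X_of_lt (show k < i + 1 by pnat_to_nat; omega)]
  rw [Sop_X_of_le hk]
  rcases pnat_trichotomy i k with hi | rfl | ⟨k, hi, rfl⟩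
  · rw [Rop_X_of_lt hi, Sop_X_of_le hk, Rop_X_of_lt (by pnat_to_nat; omega)]
  · rw [Rop_X_self, Rop_X_self, map_zero]
  · rw [Rop_X_add_one hi, Rop_X_add_one (show i + 1 ≤ k + 1 by pnat_to_nat; omega),
      Sop_X_of_le (h.trans hi)]

lemma Rop_Sop_add_one {i j : ℕ+} (h : i ≤ j) (f : PolyP) :
    Rop i (Sop (j + 1) f) = Sop j (Rop i f) := by
  suffices (Rop i).comp (Sop (j + 1)) = (Sop j).comp (Rop i) from DFunLike.congr_fun this f
  ext1 k
  simp only [AlgHom.comp_apply]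
  rcases pnat_trichotomy i k with hi | rfl | ⟨k, hi, rfl⟩
  · rw [Rop_X_of_lt hi, Sop_X_of_lt (by pnat_to_nat; omega), Rop_X_of_lt hi,
      Sop_X_of_lt (by pnat_to_nat; omega)]
  · rw [Sop_X_of_lt (by pnat_to_nat; omega), Rop_X_self, map_zero]
  rw [Rop_X_add_one hi]
  rcases lt_or_ge k j with hk | hk
  · rw [Sop_X_of_lt hk, Sop_X_of_lt (by pnat_to_nat; omega), Rop_X_add_one hi]
  · rw [Sop_X_of_le hk, Sop_X_of_le (by pnat_to_nat; omega),
      Rop_X_add_one (by pnat_to_nat; omega)]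

/-- Every polynomial has a common preimage under two consecutive Bergeron–Sottile maps. -/
lemma exists_Rop_eq_and_Rop_add_one_eq (i : ℕ+) (f : PolyP) :
    ∃ F, Rop i F = f ∧ Rop (i + 1) F = f := by
  refine ⟨Sop i f + Sop (i + 1) f - Sop i (Sop i (Rop i f)), ?_, ?_⟩
  · simp only [map_add, map_sub, Rop_Sop_self, Rop_Sop_add_one le_rfl]
    ring
  · simp only [map_add, map_sub, Rop_Sop_self, Rop_add_one_Sop le_rfl]
    ring

lemma constantCoeff_Rop (i : ℕ+) (f : PolyP) :
    constantCoeff (Rop i f) = constantCoeff f := by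
  suffices (constantCoeff (R := ℤ)).comp (Rop i : PolyP →+* PolyP) = constantCoeff from
    DFunLike.congr_fun this f
  ext k
  · simp
  · rcases pnat_trichotomy i k with hi | rfl | ⟨k, hi, rfl⟩
    · simp [Rop_X_of_lt hi]
    · simp [Rop_X_self]
    · simp [Rop_X_add_one hi]

open FreeMonoid in
/-- Induction on words by appending letters on the right. -/
lemma word_induction {motive : W → Prop} (w : W) (one : motive 1)
    (mul_of : ∀ u a, motive u → motive (u * of a)) : motive w :=
  List.reverseRecOn (motive := fun l => motive (ofList l)) (toList w) one mul_of

lemma Con.mul_left {M : Type*} [Mul M] (c : Con M) (u : M) {v w : M} (h : c v w) :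
    c (u * v) (u * w) :=
  c.mul (c.refl u) h

lemma Con.mul_right {M : Type*} [Mul M] (c : Con M) (u : M) {v w : M} (h : c v w) :
    c (v * u) (w * u) :=
  c.mul h (c.refl u)

open FreeMonoid in
/-- Up to powers of `h₁` on the left, the word `w` is congruent to a word with last letter `a`. -/
def EndsWith (w : W) (a : Letter) : Prop :=
  ∃ (N : ℕ) (v : W), conGen thompsonRel (of (.h 1) ^ N * w) (v * of a)

open FreeMonoid in
lemma endsWith_mul_of (u : W) (a : Letter) : EndsWith (u * of a) a :=
  ⟨0, u, by rw [pow_zero, one_mul]; exact Con.refl _ _⟩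

open FreeMonoid in
lemma EndsWith.mul_of {u : W} {a a' b b' : Letter} (h : EndsWith u a)
    (hr : conGen thompsonRel (of a * of b) (of b' * of a')) : EndsWith (u * of b) a' := by
  obtain ⟨N, v, h⟩ := h
  refine ⟨N, v * of b', ?_⟩
  rw [← mul_assoc, mul_assoc v]
  refine (Con.mul_right _ _ h).trans ?_
  rw [mul_assoc]
  exact Con.mul_left _ _ hr

open FreeMonoid in
lemma conGen_h_one_pow_mul_h (i : ℕ+) :
    conGen thompsonRel (of (.h 1) ^ (i : ℕ) * of (.h i)) (of (.h 1) ^ (i : ℕ) * of (.h 1)) := by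
  induction i using PNat.recOn with
  | one => exact Con.refl _ _
  | succ i ih =>
    have h : conGen thompsonRel (of (.h 1) * of (.h (i + 1))) (of (.h i) * of (.h 1)) :=
      (ConGen.Rel.of _ _ (.hh i 1 (one_le))).symm
    rw [PNat.add_coe, PNat.one_coe, pow_succ, mul_assoc]
    refine (Con.mul_left _ _ h).trans ?_
    rw [← mul_assoc]
    exact Con.mul_right _ _ ih

lemma Phi_mul_of (T : ℕ+ → Module.End ℤ PolyP) (u : W) (a : Letter) (f : PolyP) :
    Phi T (u * FreeMonoid.of a) f = Phi T u (up T a f) := by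
  rw [map_mul, Module.End.mul_apply]
  simp only [Phi, FreeMonoid.lift_eval_of]

lemma constantCoeff_Phi_h_one_pow_mul (T : ℕ+ → Module.End ℤ PolyP) (N : ℕ) (w : W)
    (f : PolyP) : constantCoeff (Phi T (FreeMonoid.of (.h 1) ^ N * w) f) =
      constantCoeff (Phi T w f) := by
  induction N with
  | zero => rw [pow_zero, one_mul]
  | succ N ih =>
    rw [pow_succ', mul_assoc, map_mul, Module.End.mul_apply, ← ih]
    exact constantCoeff_Rop 1 _

/-- The defining property of the quasisymmetric divided differences. -/
def IsQuasiDividedDifference (T : ℕ+ → Module.End ℤ PolyP) : Prop :=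
  ∀ (i : ℕ+) (f : PolyP), (X i : PolyP) * T i f = Rop (i + 1) f - Rop i f

namespace IsQuasiDividedDifference

variable {T : ℕ+ → Module.End ℤ PolyP} (hT : IsQuasiDividedDifference T)

include hT

lemma apply_eq {i : ℕ+} {f g : PolyP} (h : Rop (i + 1) f - Rop i f = X i * g) : T i f = g :=
  mul_left_cancel₀ (X_ne_zero i) ((hT i f).trans h)

lemma apply_eq_zero_iff {i : ℕ+} {f : PolyP} : T i f = 0 ↔ Rop (i + 1) f = Rop i f := by
  rw [← sub_eq_zero (a := Rop (i + 1) f), ← hT, mul_eq_zero, or_iff_right (X_ne_zero i)]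

lemma apply_one (i : ℕ+) : T i 1 = 0 := by
  simp [hT.apply_eq_zero_iff]

lemma apply_X_mul_of_lt {i j : ℕ+} (h : j < i) (f : PolyP) : T i (X j * f) = X j * T i f := by
  apply hT.apply_eq
  rw [map_mul, map_mul, Rop_X_of_lt h, Rop_X_of_lt (by pnat_to_nat; omega)]
  linear_combination -(X j : PolyP) * hT i f

lemma apply_X_add_one_mul {i j : ℕ+} (h : i < j) (f : PolyP) :
    T i (X (j + 1) * f) = X j * T i f := by
  apply hT.apply_eq
  rw [map_mul, map_mul, Rop_X_add_one h.le, Rop_X_add_one (by pnat_to_nat; omega)]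
  linear_combination -(X j : PolyP) * hT i f

lemma apply_X_self_mul (i : ℕ+) (f : PolyP) : T i (X i * f) = Rop (i + 1) f := by
  apply hT.apply_eq
  rw [map_mul, map_mul, Rop_X_self, Rop_X_of_lt (by pnat_to_nat; omega)]
  ring

lemma apply_X_succ_mul (i : ℕ+) (f : PolyP) : T i (X (i + 1) * f) = -Rop i f := by
  apply hT.apply_eq
  rw [map_mul, map_mul, Rop_X_self, Rop_X_add_one le_rfl]
  ring

lemma surjective (i : ℕ+) : Function.Surjective (T i) := fun f =>
  ⟨X i * Sop (i + 1) f, by rw [hT.apply_X_self_mul, Rop_Sop_self]⟩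

lemma apply_Rop {i j : ℕ+} (h : j ≤ i) (f : PolyP) : T i (Rop j f) = Rop j (T (i + 1) f) := by
  apply hT.apply_eq
  rw [Rop_Rop h, Rop_Rop (show j ≤ i + 1 by pnat_to_nat; omega), ← map_sub, ← hT, map_mul,
    Rop_X_add_one h]

lemma Rop_apply {i j : ℕ+} (h : j < i) (f : PolyP) : Rop i (T j f) = T j (Rop (i + 1) f) := by
  symm
  apply hT.apply_eq
  rw [← Rop_Rop (show j + 1 ≤ i by pnat_to_nat; omega), ← Rop_Rop h.le, ← map_sub, ← hT,
    map_mul, Rop_X_of_lt h]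

lemma apply_apply {i j : ℕ+} (h : j < i) (f : PolyP) : T i (T j f) = T j (T (i + 1) f) := by
  apply hT.apply_eq
  rw [hT.Rop_apply h, hT.Rop_apply (show j < i + 1 by pnat_to_nat; omega), ← map_sub, ← hT,
    hT.apply_X_add_one_mul h]

lemma up_surjective (a : Letter) : Function.Surjective (up T a) := by
  cases a with
  | g i => exact hT.surjective i
  | h i => exact fun f => ⟨Sop i f, Rop_Sop_self i f⟩

lemma Phi_surjective (w : W) : Function.Surjective (Phi T w) := by
  induction w using FreeMonoid.inductionOn' with
  | one => exact fun f => ⟨f, by simp⟩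
  | of_mul a u ih =>
    rw [map_mul, Module.End.mul_eq_comp, LinearMap.coe_comp]
    refine Function.Surjective.comp (g := Phi T (FreeMonoid.of a)) ?_ ih
    rw [Phi, FreeMonoid.lift_eval_of]
    exact hT.up_surjective a

lemma not_forall_constantCoeff_Phi_eq_zero (w : W) :
    ¬ ∀ f, constantCoeff (Phi T w f) = 0 := fun h => by
  obtain ⟨f, hf⟩ := hT.Phi_surjective w 1
  simpa [hf] using h f

lemma conGen_le_ker : conGen thompsonRel ≤ Con.ker (Phi T) := by
  refine Con.conGen_le.mpr fun u v h => ?_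
  rw [Con.ker_rel]
  refine LinearMap.ext fun f => ?_
  cases h with
  | gg i j h => exact hT.apply_apply h f
  | gh i j h => exact hT.apply_Rop h f
  | hg i j h => exact hT.Rop_apply h f
  | hh i j h => exact Rop_Rop h f

lemma conGen_h_one_pow_of_constantCoeff_Phi_eq (w : W)
    (h : ∀ f, constantCoeff (Phi T w f) = constantCoeff f) :
    ∃ N M : ℕ, conGen thompsonRel (FreeMonoid.of (.h 1) ^ N * w) (FreeMonoid.of (.h 1) ^ M) := by
  induction w using word_induction with
  | one => exact ⟨0, 0, Con.refl _ _⟩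
  | mul_of u a ih =>
    simp only [Phi_mul_of] at h
    cases a with
    | g i => simpa [up, hT.apply_one] using h 1
    | h i =>
      obtain ⟨N, M, hNM⟩ := ih fun f => by
        obtain ⟨f, rfl⟩ := hT.up_surjective (.h i) f
        rw [h]
        exact (constantCoeff_Rop i f).symm
      refine ⟨i + N, M + i + 1, ?_⟩
      rw [pow_add, mul_assoc, ← mul_assoc _ u]
      refine (Con.mul_left _ _ (Con.mul_right _ _ hNM)).trans ?_
      rw [← mul_assoc, pow_mul_comm, mul_assoc, pow_succ, pow_add, mul_assoc]
      exact Con.mul_left _ _ (conGen_h_one_pow_mul_h i)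

lemma endsWith_h (w : W) (i : ℕ+) (h : ∀ f, constantCoeff (Phi T w (X i * f)) = 0) :
    EndsWith w (.h i) := by
  induction w using word_induction generalizing i with
  | one =>
    refine ⟨i + 1, FreeMonoid.of (.h 1) ^ (i : ℕ), ?_⟩
    rw [mul_one, pow_succ]
    exact (conGen_h_one_pow_mul_h i).symm
  | mul_of u a ih =>
    simp only [Phi_mul_of] at h
    cases a with
    | h j =>
      change ∀ f, constantCoeff (Phi T u (Rop j (X i * f))) = 0 at h
      rcases pnat_trichotomy j i with hij | rfl | ⟨i, hij, rfl⟩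
      · obtain ⟨j, rfl⟩ : ∃ k, j = k + 1 := PNat.exists_eq_succ_of_ne_one
          (by rintro rfl; exact not_lt_one hij)
        refine (ih i fun f => ?_).mul_of
          (ConGen.Rel.of _ _ (.hh j i (PNat.lt_add_one_iff.mp hij))).symm
        simpa [Rop_X_of_lt hij, Rop_Sop_self] using h (Sop (j + 1) f)
      · exact endsWith_mul_of u _
      · refine (ih i fun f => ?_).mul_of (ConGen.Rel.of _ _ (.hh i j hij))
        simpa [Rop_X_add_one hij, Rop_Sop_self] using h (Sop j f)
    | g j =>
      change ∀ f, constantCoeff (Phi T u (T j (X i * f))) = 0 at h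
      rcases pnat_trichotomy j i with hij | rfl | ⟨i, hij, rfl⟩
      · obtain ⟨j, rfl⟩ : ∃ k, j = k + 1 := PNat.exists_eq_succ_of_ne_one
          (by rintro rfl; exact not_lt_one hij)
        refine (ih i fun f => ?_).mul_of
          (ConGen.Rel.of _ _ (.gh j i (PNat.lt_add_one_iff.mp hij))).symm
        obtain ⟨f, rfl⟩ := hT.surjective (j + 1) f
        rw [← hT.apply_X_mul_of_lt hij, h]
      · refine (hT.not_forall_constantCoeff_Phi_eq_zero u fun f => ?_).elim
        simpa [hT.apply_X_self_mul, Rop_Sop_self] using h (Sop (i + 1) f)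
      · rcases hij.eq_or_lt with rfl | hij
        · refine (hT.not_forall_constantCoeff_Phi_eq_zero u fun f => ?_).elim
          simpa [hT.apply_X_succ_mul, Rop_Sop_self] using h (Sop j f)
        · refine (ih i fun f => ?_).mul_of (ConGen.Rel.of _ _ (.hg i j hij))
          obtain ⟨f, rfl⟩ := hT.surjective j f
          rw [← hT.apply_X_add_one_mul hij, h]

lemma endsWith_g (w : W) (i : ℕ+) (h : ∀ f, T i f = 0 → constantCoeff (Phi T w f) = 0) :
    EndsWith w (.g i) := by
  induction w using word_induction generalizing i with
  | one => simpa using h 1 (hT.apply_one i)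
  | mul_of u a ih =>
    simp only [Phi_mul_of, hT.apply_eq_zero_iff] at h ih
    cases a with
    | h j =>
      change ∀ f, _ → constantCoeff (Phi T u (Rop j f)) = 0 at h
      rcases pnat_trichotomy j i with hij | rfl | ⟨i, hij, rfl⟩
      · obtain ⟨j, rfl⟩ : ∃ k, j = k + 1 := PNat.exists_eq_succ_of_ne_one
          (by rintro rfl; exact not_lt_one hij)
        rcases (PNat.lt_add_one_iff.mp hij).eq_or_lt with rfl | hij
        · refine (hT.not_forall_constantCoeff_Phi_eq_zero u fun f => ?_).elim
          obtain ⟨F, h₁, h₂⟩ := exists_Rop_eq_and_Rop_add_one_eq i f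
          simpa [h₂] using h F (h₂.trans h₁.symm)
        · refine (ih i fun f hf => ?_).mul_of (ConGen.Rel.of _ _ (.hg j i hij)).symm
          rw [← Rop_Sop_self (j + 1) f]
          refine h _ ?_
          rw [Rop_Sop_add_one (show i + 1 ≤ j by pnat_to_nat; omega), hf, Rop_Sop_add_one hij.le]
      · refine (hT.not_forall_constantCoeff_Phi_eq_zero u fun f => ?_).elim
        obtain ⟨F, h₁, h₂⟩ := exists_Rop_eq_and_Rop_add_one_eq i f
        simpa [h₁] using h F (h₂.trans h₁.symm)
      · refine (ih i fun f hf => ?_).mul_of (ConGen.Rel.of _ _ (.gh i j hij))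
        rw [← Rop_Sop_self j f]
        refine h _ ?_
        rw [Rop_add_one_Sop (show j ≤ i + 1 by pnat_to_nat; omega), hf, Rop_add_one_Sop hij]
    | g j =>
      change ∀ f, _ → constantCoeff (Phi T u (T j f)) = 0 at h
      have lift (f : PolyP) : T j (X j * Sop (j + 1) f) = f := by
        rw [hT.apply_X_self_mul, Rop_Sop_self]
      rcases pnat_trichotomy j i with hij | rfl | ⟨i, hij, rfl⟩
      · obtain ⟨j, rfl⟩ : ∃ k, j = k + 1 := PNat.exists_eq_succ_of_ne_one
          (by rintro rfl; exact not_lt_one hij)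
        rcases (PNat.lt_add_one_iff.mp hij).eq_or_lt with rfl | hij'
        · refine (hT.not_forall_constantCoeff_Phi_eq_zero u fun f => ?_).elim
          obtain ⟨F, h₁, h₂⟩ := exists_Rop_eq_and_Rop_add_one_eq i f
          have := h (-(X (i + 1 + 1) * F)) (by
            simp only [map_neg, map_mul, h₁, h₂, Rop_X_add_one (le_refl (i + 1)),
              Rop_X_add_one (show i ≤ i + 1 by pnat_to_nat; omega)])
          simpa [hT.apply_X_succ_mul, h₂] using this
        · refine (ih i fun f hf => ?_).mul_of (ConGen.Rel.of _ _ (.gg j i hij')).symm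
          rw [← lift f]
          refine h _ ?_
          rw [map_mul, map_mul, Rop_X_add_one (show i + 1 ≤ j by pnat_to_nat; omega),
            Rop_X_add_one hij'.le, Rop_Sop_add_one (show i + 1 ≤ j + 1 by pnat_to_nat; omega), hf,
            Rop_Sop_add_one hij.le]
      · exact endsWith_mul_of u _
      · rcases hij.eq_or_lt with rfl | hij
        · refine (hT.not_forall_constantCoeff_Phi_eq_zero u fun f => ?_).elim
          obtain ⟨F, h₁, h₂⟩ := exists_Rop_eq_and_Rop_add_one_eq (j + 1) f
          have := h (X j * F) (by
            simp only [map_mul, h₁, h₂, Rop_X_of_lt (show j < j + 1 by pnat_to_nat; omega),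
              Rop_X_of_lt (show j < j + 1 + 1 by pnat_to_nat; omega)])
          simpa [hT.apply_X_self_mul, h₁] using this
        · refine (ih i fun f hf => ?_).mul_of (ConGen.Rel.of _ _ (.gg i j hij))
          rw [← lift f]
          refine h _ ?_
          rw [map_mul, map_mul, Rop_X_of_lt (show j < i + 1 by pnat_to_nat; omega),
            Rop_X_of_lt (show j < i + 1 + 1 by pnat_to_nat; omega),
            Rop_add_one_Sop (show j + 1 ≤ i + 1 by pnat_to_nat; omega), hf,
            Rop_add_one_Sop (show j + 1 ≤ i by pnat_to_nat; omega)]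

lemma endsWith_of_forall_up_eq_zero (w : W) (a : Letter)
    (h : ∀ f, up T a f = 0 → constantCoeff (Phi T w f) = 0) : EndsWith w a := by
  cases a with
  | g i => exact hT.endsWith_g w i h
  | h i =>
    refine hT.endsWith_h w i fun f => h _ ?_
    change Rop i (X i * f) = 0
    rw [map_mul, Rop_X_self, zero_mul]

lemma constantCoeff_Phi_eq_of_conGen {w w' : W} {N M : ℕ}
    (h : conGen thompsonRel (FreeMonoid.of (.h 1) ^ N * w) (FreeMonoid.of (.h 1) ^ M * w'))
    (f : PolyP) : constantCoeff (Phi T w f) = constantCoeff (Phi T w' f) := by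
  have h : Phi T _ = Phi T _ := hT.conGen_le_ker h
  rw [← constantCoeff_Phi_h_one_pow_mul T N, h, constantCoeff_Phi_h_one_pow_mul]

lemma exists_conGen_of_constantCoeff_Phi_eq (w w' : W)
    (h : ∀ f, constantCoeff (Phi T w f) = constantCoeff (Phi T w' f)) :
    ∃ N M : ℕ, conGen thompsonRel
      (FreeMonoid.of (.h 1) ^ N * w) (FreeMonoid.of (.h 1) ^ M * w') := by
  induction w using word_induction generalizing w' with
  | one =>
    obtain ⟨N, M, hNM⟩ := hT.conGen_h_one_pow_of_constantCoeff_Phi_eq w' fun f => by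
      rw [← h, map_one, Module.End.one_apply]
    exact ⟨M, N, by rw [mul_one]; exact hNM.symm⟩
  | mul_of u a ih =>
    obtain ⟨K, v, hv⟩ := hT.endsWith_of_forall_up_eq_zero w' a fun f hf => by
      rw [← h, Phi_mul_of, hf, map_zero, map_zero]
    obtain ⟨N, M, hNM⟩ := ih v fun f => by
      obtain ⟨f, rfl⟩ := hT.up_surjective a f
      have hv : Phi T _ = Phi T _ := hT.conGen_le_ker hv
      rw [← Phi_mul_of, ← Phi_mul_of, h, ← hv, constantCoeff_Phi_h_one_pow_mul]
    refine ⟨N, M + K, ?_⟩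
    rw [← mul_assoc, pow_add, mul_assoc _ _ w']
    refine (Con.mul_right _ _ hNM).trans ?_
    rw [mul_assoc]
    exact Con.mul_left (conGen thompsonRel) _ hv.symm

end IsQuasiDividedDifference

theorem stmt10 (T : ℕ+ → Module.End ℤ PolyP)
    (hT : ∀ (i : ℕ+) (f : PolyP),
      (MvPolynomial.X i : PolyP) * T i f = Rop (i + 1) f - Rop i f)
    (w w' : W) :
    (∀ f : PolyP,
        MvPolynomial.constantCoeff (Phi T w f) = MvPolynomial.constantCoeff (Phi T w' f)) ↔
      ∃ N M : ℕ, conGen thompsonRel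
        ((FreeMonoid.of (Letter.h 1)) ^ N * w) ((FreeMonoid.of (Letter.h 1)) ^ M * w') := by
  exact ⟨IsQuasiDividedDifference.exists_conGen_of_constantCoeff_Phi_eq hT w w',
    fun ⟨_, _, h⟩ => IsQuasiDividedDifference.constantCoeff_Phi_eq_of_conGen hT h⟩
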